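/- arXiv:2601.10262 — 5 statements merged into one kernel-verified Lean document; each statement's English description precedes it below -/
import Mathlib

section
/- The following matrix identities hold over 𝔽₂: (i) G_N·G_N = I_N (so G_N = G_N^{−1}); (ii) Q_π·G_N = (G_N·Q_π)^{−1}; (iii) (G_N·Q_π)² = Q_π·G_N; (iv) G_N·Q_π·G_N = Q_π·G_N·Q_π. -/
/-- The set of positions of nonzero bits (within `{0,…,m−1}`) of the binary expansion of `i`. -/
def bsupp (m i : ℕ) : Finset ℕ := (Finset.range m).filter fun k => i.testBit k

/-- The polar transform matrix `G_N`, `N = 2^m`: entry `(i,j)` is `1` iff `supp j ⊆ supp i`. -/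
def GN (m : ℕ) : Matrix (Fin (2^m)) (Fin (2^m)) (ZMod 2) :=
  fun i j => if bsupp m (j : ℕ) ⊆ bsupp m (i : ℕ) then 1 else 0

/-- The permutation matrix swapping `i` and `N−1−i`. -/
def Qpi (m : ℕ) : Matrix (Fin (2^m)) (Fin (2^m)) (ZMod 2) :=
  fun i j => if (j : ℕ) = 2^m - 1 - (i : ℕ) then 1 else 0

theorem bsupp_subset_range (m i : ℕ) : bsupp m i ⊆ Finset.range m :=
  Finset.filter_subset _ _

theorem bsupp_injective (m : ℕ) :
    Function.Injective fun i : Fin (2 ^ m) => bsupp m (i : ℕ) := by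
  intro i j h
  refine Fin.ext (Nat.eq_of_testBit_eq fun k => ?_)
  by_cases hk : k < m
  · rw [Bool.eq_iff_iff]
    simpa [bsupp, hk] using Finset.ext_iff.mp h k
  · have hle : 2 ^ m ≤ 2 ^ k := Nat.pow_le_pow_right two_pos (not_lt.mp hk)
    rw [Nat.testBit_lt_two_pow (i.isLt.trans_le hle), Nat.testBit_lt_two_pow (j.isLt.trans_le hle)]

theorem bsupp_rev {m : ℕ} (i : Fin (2 ^ m)) :
    bsupp m (i.rev : ℕ) = Finset.range m \ bsupp m (i : ℕ) := by
  ext k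
  rw [Fin.val_rev]
  simp +contextual [bsupp, Nat.testBit_two_pow_sub_succ i.isLt]

theorem image_bsupp (m : ℕ) :
    Finset.univ.image (fun i : Fin (2 ^ m) => bsupp m (i : ℕ)) = (Finset.range m).powerset := by
  refine Finset.eq_of_subset_of_card_le ?_ ?_
  · simp [Finset.image_subset_iff, bsupp_subset_range]
  · simp [Finset.card_image_of_injective _ (bsupp_injective m)]

theorem sum_bsupp {M : Type*} [AddCommMonoid M] (m : ℕ) (f : Finset ℕ → M) :
    ∑ i : Fin (2 ^ m), f (bsupp m (i : ℕ)) = ∑ s ∈ (Finset.range m).powerset, f s := by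
  rw [← image_bsupp, Finset.sum_image (bsupp_injective m).injOn]

theorem GN_mul_self (m : ℕ) : GN m * GN m = 1 := by
  ext i j
  have hcard : (GN m * GN m) i j = ((Finset.Icc (bsupp m j) (bsupp m i)).card : ZMod 2) := by
    simp only [Matrix.mul_apply, GN]
    rw [sum_bsupp m fun s =>
      (if s ⊆ bsupp m (i : ℕ) then (1 : ZMod 2) else 0) * if bsupp m (j : ℕ) ⊆ s then 1 else 0]
    simp only [← ite_and, mul_ite, mul_one, mul_zero, Finset.sum_boole]
    congr 2
    ext s
    have := bsupp_subset_range m i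
    simp only [Finset.mem_filter, Finset.mem_powerset, Finset.mem_Icc]
    exact ⟨fun h => h.2, fun h => ⟨h.2.trans this, h⟩⟩
  rw [hcard]
  by_cases hij : i = j
  · subst hij
    simp
  · rw [Matrix.one_apply_ne hij]
    by_cases hsub : bsupp m (j : ℕ) ⊆ bsupp m (i : ℕ)
    · have hss : bsupp m (j : ℕ) ⊂ bsupp m (i : ℕ) :=
        hsub.ssubset_of_ne fun h => hij (bsupp_injective m h).symm
      have hlt := Finset.card_lt_card hss
      rw [Finset.card_Icc_finset hsub, Nat.cast_pow, show ((2 : ℕ) : ZMod 2) = 0 from rfl,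
        zero_pow (by omega)]
    · rw [Finset.Icc_eq_empty hsub]
      simp

theorem Qpi_apply {m : ℕ} (i j : Fin (2 ^ m)) : Qpi m i j = if j = i.rev then 1 else 0 := by
  simp only [Qpi, Fin.ext_iff, Fin.val_rev]
  congr 2
  omega

theorem Qpi_mul_apply {m : ℕ} (A : Matrix (Fin (2 ^ m)) (Fin (2 ^ m)) (ZMod 2))
    (i j : Fin (2 ^ m)) : (Qpi m * A) i j = A i.rev j := by
  simp [Matrix.mul_apply, Qpi_apply]

theorem mul_Qpi_apply {m : ℕ} (A : Matrix (Fin (2 ^ m)) (Fin (2 ^ m)) (ZMod 2))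
    (i j : Fin (2 ^ m)) : (A * Qpi m) i j = A i j.rev := by
  have hrev (k : Fin (2 ^ m)) : j = k.rev ↔ k = j.rev := by
    rw [← Fin.rev_eq_iff, eq_comm]
  simp [Matrix.mul_apply, Qpi_apply, hrev]

theorem Qpi_mul_self (m : ℕ) : Qpi m * Qpi m = 1 := by
  ext i j
  simp [Qpi_mul_apply, Qpi_apply, Matrix.one_apply, eq_comm]

theorem GN_mul_Qpi_mul_GN (m : ℕ) : GN m * Qpi m * GN m = Qpi m * GN m * Qpi m := by
  ext i j
  have hi := bsupp_subset_range m i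
  have hj := bsupp_subset_range m j
  have hcard : (GN m * Qpi m * GN m) i j =
      ((bsupp m i \ bsupp m j).powerset.card : ZMod 2) := by
    rw [Matrix.mul_assoc]
    simp only [Matrix.mul_apply (M := GN m), Qpi_mul_apply, GN, bsupp_rev]
    rw [sum_bsupp m fun s => (if s ⊆ bsupp m (i : ℕ) then (1 : ZMod 2) else 0) *
      if bsupp m (j : ℕ) ⊆ Finset.range m \ s then 1 else 0]
    simp only [← ite_and, mul_ite, mul_one, mul_zero, Finset.sum_boole]
    congr 2
    ext s
    simp only [Finset.mem_filter, Finset.mem_powerset]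
    grind
  have hiff : Finset.range m \ bsupp m j ⊆ Finset.range m \ bsupp m i ↔
      bsupp m i \ bsupp m j = ∅ := by
    rw [Finset.sdiff_eq_empty_iff_subset, Finset.sdiff_subset_sdiff_iff_subset hj hi]
  rw [hcard, mul_Qpi_apply, Qpi_mul_apply, Finset.card_powerset, Nat.cast_pow,
    show ((2 : ℕ) : ZMod 2) = 0 from rfl, zero_pow_eq]
  simp only [GN, bsupp_rev, hiff, Finset.card_eq_zero]

/-- over `𝔽₂`, (i) `G_N·G_N = I_N` (so `G_N = G_N⁻¹`);
(ii) `Q_π·G_N = (G_N·Q_π)⁻¹`; (iii) `(G_N·Q_π)² = Q_π·G_N`;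
(iv) `G_N·Q_π·G_N = Q_π·G_N·Q_π`. -/
theorem stmt1 (m : ℕ) (hm : 0 < m) :
    (GN m * GN m = 1 ∧ GN m = (GN m)⁻¹)
    ∧ Qpi m * GN m = (GN m * Qpi m)⁻¹
    ∧ (GN m * Qpi m) ^ 2 = Qpi m * GN m
    ∧ GN m * Qpi m * GN m = Qpi m * GN m * Qpi m := by
  have hG := GN_mul_self m
  have hQ := Qpi_mul_self m
  have hGQG := GN_mul_Qpi_mul_GN m
  refine ⟨⟨hG, (Matrix.inv_eq_right_inv hG).symm⟩, (Matrix.inv_eq_right_inv ?_).symm, ?_, hGQG⟩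
  · rw [Matrix.mul_assoc, ← Matrix.mul_assoc (Qpi m), hQ, Matrix.one_mul, hG]
  · rw [pow_two, ← Matrix.mul_assoc, hGQG, Matrix.mul_assoc, hQ, Matrix.mul_one]
end

section
/- Let T₁ and T₂ be finite families of subsets of {0,…,m−1}, and let P₁ = Σ_{S∈T₁} ∏_{k∈S} x_k and P₂ = Σ_{S'∈T₂} ∏_{k∈S'} x_k be the corresponding squarefree polynomials over 𝔽₂. Then Σ_{x ∈ 𝔽₂^m} P₁(x)·P₂(x) = 0 in 𝔽₂ if and only if the number of pairs (S, S') ∈ T₁ × T₂ with S ∪ S' = {0,…,m−1} is even. (In other words, the evaluation vectors of P₁ and P₂ are orthogonal if and only if the full monomial x_0⋯x_{m−1} does not appear among the terms of the reduced product P₁·P₂.) -/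
/-- Over `𝔽₂`, a squarefree monomial sums to `1` over the whole space if it is the full monomial,
and to `0` otherwise. -/
theorem sum_prod_zmod_two {ι : Type*} [Fintype ι] [DecidableEq ι] (S : Finset ι) :
    ∑ x : ι → ZMod 2, ∏ k ∈ S, x k = if S = Finset.univ then 1 else 0 := by
  have hsum : ∀ k : ι, ∑ a : ZMod 2, (if k ∈ S then a else 1) = if k ∈ S then 1 else 0 := by
    intro k
    split_ifs <;> decide
  calc ∑ x : ι → ZMod 2, ∏ k ∈ S, x k
      = ∑ x : ι → ZMod 2, ∏ k, if k ∈ S then x k else 1 := by simp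
    _ = ∏ k, ∑ a : ZMod 2, (if k ∈ S then a else 1) :=
        (Fintype.prod_sum fun (k : ι) (a : ZMod 2) => if k ∈ S then a else 1).symm
    _ = if S = Finset.univ then 1 else 0 := by
        simp_rw [hsum, Finset.prod_ite_zero, Finset.prod_const_one, Finset.eq_univ_iff_forall,
          Finset.mem_univ, true_imp_iff]

/-- Over `𝔽₂`, the product of two squarefree monomials takes the same values as the squarefree
monomial on the union of their variables. -/
theorem prod_mul_prod_zmod_two {ι : Type*} [DecidableEq ι] (S S' : Finset ι) (x : ι → ZMod 2) :
    (∏ k ∈ S, x k) * ∏ k ∈ S', x k = ∏ k ∈ S ∪ S', x k := by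
  have hsq : ∀ a : ZMod 2, a * a = a := by decide
  rw [← Finset.prod_union_inter, ← Finset.prod_sdiff
    (Finset.inter_subset_left.trans Finset.subset_union_left : S ∩ S' ⊆ S ∪ S'), mul_assoc, hsq]

/-- let `T₁, T₂` be finite families of subsets of `{0,…,m−1}` and
`P₁ = Σ_{S∈T₁} ∏_{k∈S} x_k`, `P₂ = Σ_{S'∈T₂} ∏_{k∈S'} x_k` the corresponding squarefree
polynomials over `𝔽₂`.  Then `Σ_{x ∈ 𝔽₂^m} P₁(x)·P₂(x) = 0` iff the number of pairs
`(S, S') ∈ T₁ × T₂` with `S ∪ S' = {0,…,m−1}` is even. -/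
theorem stmt5 (m : ℕ) (hm : 0 < m) (T₁ T₂ : Finset (Finset (Fin m))) :
    (∑ x : Fin m → ZMod 2,
        (∑ S ∈ T₁, ∏ k ∈ S, x k) * (∑ S' ∈ T₂, ∏ k ∈ S', x k) = 0)
    ↔ Even ((T₁ ×ˢ T₂).filter
        (fun p => p.1 ∪ p.2 = (Finset.univ : Finset (Fin m)))).card := by
  have hcard : ∑ x : Fin m → ZMod 2,
      (∑ S ∈ T₁, ∏ k ∈ S, x k) * (∑ S' ∈ T₂, ∏ k ∈ S', x k) =
      (((T₁ ×ˢ T₂).filter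
        (fun p => p.1 ∪ p.2 = (Finset.univ : Finset (Fin m)))).card : ZMod 2) := by
    simp_rw [Finset.sum_mul_sum, ← Finset.sum_product', prod_mul_prod_zmod_two]
    rw [Finset.sum_product_right]
    simp_rw [sum_prod_zmod_two, Finset.sum_boole]
  rw [hcard, ZMod.natCast_eq_zero_iff_even]
end

section
/- Let P be an N×N upper triangular matrix over 𝔽₂ with all diagonal entries equal to 1. Then for all i, j ∈ {0,…,N−1} with j > i, row N−1−i of G_N is orthogonal to row j of P·G_N; that is, Σ_{k=0}^{N−1} (G_N)_{N−1−i,k}·(P·G_N)_{j,k} = 0 in 𝔽₂. -/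
/-- The index reversal `i ↦ N − 1 − i` on `Fin (2^m)`. -/
def rev (m : ℕ) (i : Fin (2^m)) : Fin (2^m) :=
  ⟨2^m - 1 - (i : ℕ), by have := i.isLt; omega⟩

theorem mem_bsupp {m i t : ℕ} : t ∈ bsupp m i ↔ t < m ∧ i.testBit t = true := by
  simp [bsupp]

theorem exists_testBit_of_lt {i l : ℕ} (h : i < l) :
    ∃ t, l.testBit t = true ∧ i.testBit t = false := by
  by_contra! hc
  have hand : l &&& i = l := by
    apply Nat.eq_of_testBit_eq
    intro t
    have := hc t
    rw [Nat.testBit_and]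
    cases hl : l.testBit t <;> simp_all
  have hle : l &&& i ≤ i := Nat.and_le_right
  omega

/-- Flipping the bit `t < m` of an index in `Fin (2^m)`. -/
def flipBit (m t : ℕ) (ht : t < m) (k : Fin (2^m)) : Fin (2^m) :=
  ⟨(k : ℕ) ^^^ 2^t, Nat.xor_lt_two_pow k.isLt (Nat.pow_lt_pow_right (by norm_num) ht)⟩

theorem bsupp_flipBit_subset_iff {m t a : ℕ} (ht : t < m) (ha : t ∈ bsupp m a) (k : Fin (2^m)) :
    bsupp m (flipBit m t ht k) ⊆ bsupp m a ↔ bsupp m k ⊆ bsupp m a := by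
  have hmem : ∀ s, s ≠ t → (s ∈ bsupp m (flipBit m t ht k) ↔ s ∈ bsupp m k) := by
    intro s hs
    simp [mem_bsupp, flipBit, Nat.testBit_xor, hs.symm]
  constructor <;> intro h s hs <;> by_cases hst : s = t
  · rwa [hst]
  · exact h ((hmem s hst).2 hs)
  · rwa [hst]
  · exact h ((hmem s hst).1 hs)

/-- Two rows of `G_N` whose indices share a nonzero bit are orthogonal. -/
theorem sum_GN_mul_GN_eq_zero {m t : ℕ} {a b : Fin (2^m)} (ha : t ∈ bsupp m a)
    (hb : t ∈ bsupp m b) : ∑ k, GN m a k * GN m b k = 0 := by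
  have ht : t < m := (mem_bsupp.1 ha).1
  refine Finset.sum_involution (fun k _ => flipBit m t ht k) ?_ ?_ (by simp) ?_
  · intro k _
    simp only [GN, bsupp_flipBit_subset_iff ht ha, bsupp_flipBit_subset_iff ht hb]
    exact CharTwo.add_self_eq_zero _
  · intro k _ _ h
    have hbit := congrArg (fun x : Fin (2^m) => (x : ℕ).testBit t) h
    simp [flipBit, Nat.testBit_xor] at hbit
  · intro k _
    simp [flipBit]

theorem exists_mem_bsupp_rev {m : ℕ} {i l : Fin (2^m)} (h : i < l) :
    ∃ t, t ∈ bsupp m (rev m i) ∧ t ∈ bsupp m l := by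
  obtain ⟨t, hl, hi⟩ := exists_testBit_of_lt (Fin.lt_def.1 h)
  have ht : t < m := by
    by_contra! hmt
    have := Nat.testBit_lt_two_pow (l.isLt.trans_le (Nat.pow_le_pow_right (by norm_num) hmt))
    simp_all
  refine ⟨t, mem_bsupp.2 ⟨ht, ?_⟩, mem_bsupp.2 ⟨ht, hl⟩⟩
  have hrev : (rev m i : ℕ) = 2^m - ((i : ℕ) + 1) := by simp only [rev]; omega
  rw [hrev, Nat.testBit_two_pow_sub_succ i.isLt]
  simp [ht, hi]

/-- let `P` be an `N×N` upper triangular matrix over `𝔽₂` with all diagonal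
entries equal to `1`.  Then for all `i, j` with `j > i`, row `N−1−i` of `G_N` is orthogonal
to row `j` of `P·G_N`: `Σ_k (G_N)_{N−1−i,k}·(P·G_N)_{j,k} = 0`. -/
theorem stmt6 (m : ℕ) (hm : 0 < m)
    (P : Matrix (Fin (2^m)) (Fin (2^m)) (ZMod 2))
    (hupper : ∀ i j : Fin (2^m), j < i → P i j = 0)
    (hdiag : ∀ i : Fin (2^m), P i i = 1)
    (i j : Fin (2^m)) (hij : i < j) :
    ∑ k : Fin (2^m), GN m (rev m i) k * (P * GN m) j k = 0 := by
  simp only [Matrix.mul_apply, Finset.mul_sum]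
  rw [Finset.sum_comm]
  refine Finset.sum_eq_zero fun l _ => ?_
  rcases lt_or_ge l j with hlj | hjl
  · simp [hupper j l hlj]
  · obtain ⟨t, hti, htl⟩ := exists_mem_bsupp_rev (hij.trans_le hjl)
    simp_rw [mul_left_comm _ (P j l), ← Finset.mul_sum]
    rw [sum_GN_mul_GN_eq_zero hti htl, mul_zero]
end

section
/- Let P be an N×N upper triangular matrix over 𝔽₂ with all diagonal entries equal to 1, and let M be the N×N matrix over 𝔽₂ with entries M_{i,j} = Σ_{l : supp(l) ⊆ supp(i)} P_{j,l}. Then M is lower triangular (M_{i,j} = 0 whenever j > i) with M_{i,i} = 1 for all i ∈ {0,…,N−1}; in particular M is invertible over 𝔽₂. -/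
/-- Given `P`, the matrix `M` with `M_{i,j} = Σ_{l : supp(l) ⊆ supp(i)} P_{j,l}` (sum in `𝔽₂`). -/
def Mmat (m : ℕ) (P : Matrix (Fin (2^m)) (Fin (2^m)) (ZMod 2)) :
    Matrix (Fin (2^m)) (Fin (2^m)) (ZMod 2) :=
  fun i j => ∑ l ∈ Finset.univ.filter
      (fun l : Fin (2^m) => bsupp m (l : ℕ) ⊆ bsupp m (i : ℕ)), P j l

/-- If the binary support of `l < 2 ^ m` is contained in that of `i`, then `l ≤ i`. -/
theorem le_of_bsupp_subset {m l i : ℕ} (hl : l < 2 ^ m) (h : bsupp m l ⊆ bsupp m i) : l ≤ i := by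
  have hand : l &&& i = l := by
    refine Nat.eq_of_testBit_eq fun k => ?_
    rw [Nat.testBit_and]
    by_cases hk : l.testBit k = true
    · have hkm : k < m := by
        by_contra! hmk
        rw [Nat.testBit_lt_two_pow (hl.trans_le (Nat.pow_le_pow_right two_pos hmk))] at hk
        exact Bool.false_ne_true hk
      have hik : k ∈ bsupp m i :=
        h (Finset.mem_filter.mpr ⟨Finset.mem_range.mpr hkm, hk⟩)
      rw [(Finset.mem_filter.mp hik).2, Bool.and_true]
    · simp [hk]
  exact hand ▸ Nat.and_le_right

/-- let `P` be an `N×N` upper triangular matrix over `𝔽₂` with all diagonal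
entries equal to `1`, and let `M_{i,j} = Σ_{l : supp(l) ⊆ supp(i)} P_{j,l}`.  Then `M` is
lower triangular with unit diagonal; in particular `M` is invertible over `𝔽₂`. -/
theorem stmt7 (m : ℕ) (hm : 0 < m)
    (P : Matrix (Fin (2^m)) (Fin (2^m)) (ZMod 2))
    (hupper : ∀ i j : Fin (2^m), j < i → P i j = 0)
    (hdiag : ∀ i : Fin (2^m), P i i = 1) :
    (∀ i j : Fin (2^m), i < j → Mmat m P i j = 0)
    ∧ (∀ i : Fin (2^m), Mmat m P i i = 1)
    ∧ IsUnit (Mmat m P) := by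
  have hlow : ∀ i j : Fin (2^m), i < j → Mmat m P i j = 0 := fun i j hij =>
    Finset.sum_eq_zero fun l hl => hupper j l <| lt_of_le_of_lt
      (Fin.le_def.mpr (le_of_bsupp_subset l.isLt (Finset.mem_filter.mp hl).2)) hij
  have hone : ∀ i : Fin (2^m), Mmat m P i i = 1 := by
    intro i
    rw [← hdiag i]
    refine Finset.sum_eq_single i (fun l hl hne => hupper i l ?_) (fun hi => ?_)
    · exact lt_of_le_of_ne
        (Fin.le_def.mpr (le_of_bsupp_subset l.isLt (Finset.mem_filter.mp hl).2)) hne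
    · exact absurd (Finset.mem_filter.mpr ⟨Finset.mem_univ i, Finset.Subset.refl _⟩) hi
  refine ⟨hlow, hone, ?_⟩
  rw [Matrix.isUnit_iff_isUnit_det, Matrix.det_of_isLowerTriangular _ fun i j hij => hlow i j hij]
  simp [hone]
end

section
/- Let 0 ≤ r ≤ m. The code C_{G_N}({N−2^r,…,N−1}) spanned by the last 2^r rows of G_N has minimum distance 2^{m−r}, and it contains exactly 2^r codewords of Hamming weight 2^{m−r}. -/
/-- The linear code spanned by the rows of `B` with index in `A`. -/
def code {N : ℕ} (B : Matrix (Fin N) (Fin N) (ZMod 2)) (A : Set (Fin N)) :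
    Submodule (ZMod 2) (Fin N → ZMod 2) :=
  Submodule.span (ZMod 2) ((fun i => B i) '' A)

/-- Hamming weight of a vector in `𝔽₂^N`. -/
def wt {N : ℕ} (v : Fin N → ZMod 2) : ℕ := (Finset.univ.filter fun k => v k ≠ 0).card

/-- Periodic extension of a vector of length `2^r` to a vector of length `2^m`. -/
def periodicExt (m r : ℕ) : (Fin (2^r) → ZMod 2) →ₗ[ZMod 2] (Fin (2^m) → ZMod 2) :=
  LinearMap.funLeft (ZMod 2) (ZMod 2)
    fun j : Fin (2^m) => (⟨(j : ℕ) % 2^r, Nat.mod_lt _ (by positivity)⟩ : Fin (2^r))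

lemma periodicExt_apply (m r : ℕ) (u : Fin (2^r) → ZMod 2) (j : Fin (2^m)) :
    periodicExt m r u j = u ⟨(j : ℕ) % 2^r, Nat.mod_lt _ (by positivity)⟩ := rfl

lemma periodicExt_injective {m r : ℕ} (hr : r ≤ m) : Function.Injective (periodicExt m r) := by
  apply LinearMap.funLeft_injective_of_surjective
  intro k
  exact ⟨⟨k, k.2.trans_le (Nat.pow_le_pow_right (by norm_num) hr)⟩,
    Fin.ext (Nat.mod_eq_of_lt k.2)⟩

lemma wt_periodicExt {m r : ℕ} (hr : r ≤ m) (u : Fin (2^r) → ZMod 2) :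
    wt (periodicExt m r u) = 2^(m-r) * wt u := by
  obtain ⟨s, rfl⟩ := Nat.exists_eq_add_of_le' hr
  let e : Fin (2^s) × Fin (2^r) ≃ Fin (2^(s+r)) :=
    finProdFinEquiv.trans (finCongr (pow_add 2 s r).symm)
  have he (p : Fin (2^s) × Fin (2^r)) : periodicExt (s+r) r u (e p) = u p.2 := by
    rw [periodicExt_apply]
    congr 1
    apply Fin.ext
    simp [e, Nat.mod_eq_of_lt]
  have hprod : (Finset.univ.filter fun p : Fin (2^s) × Fin (2^r) => u p.2 ≠ 0) =
      Finset.univ ×ˢ (Finset.univ.filter fun k => u k ≠ 0) := by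
    ext p; simp
  have hcard : wt (periodicExt (s+r) r u) =
      (Finset.univ.filter fun p : Fin (2^s) × Fin (2^r) => u p.2 ≠ 0).card := by
    symm
    apply Finset.card_equiv e
    intro p
    simp [he]
  rw [hcard, hprod, Finset.card_product]
  simp [wt]

lemma testBit_of_two_pow_sub_le {m r i k : ℕ} (hr : r ≤ m) (hi : 2^m - 2^r ≤ i)
    (him : i < 2^m) (hrk : r ≤ k) (hkm : k < m) : i.testBit k = true := by
  obtain ⟨s, rfl⟩ := Nat.exists_eq_add_of_le' hr
  have hdiv : i / 2^r = 2^s - 1 := by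
    rw [Nat.div_eq_iff (by positivity)]
    have h1 : 1 ≤ 2^s := Nat.one_le_two_pow
    have h2 : 1 ≤ 2^r := Nat.one_le_two_pow
    rw [pow_add] at hi him
    rw [Nat.sub_mul, one_mul]
    have : 2^r ≤ 2^s * 2^r := Nat.le_mul_of_pos_left _ h1
    omega
  have h := Nat.testBit_div_two_pow (n := r) i (k - r)
  rw [hdiv, Nat.testBit_two_pow_sub_one, Nat.sub_add_cancel hrk] at h
  rw [← h]
  simp
  omega

lemma bsupp_subset_iff_mod {m r i : ℕ} (hr : r ≤ m) (hi : 2^m - 2^r ≤ i) (him : i < 2^m)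
    (j : ℕ) : bsupp m j ⊆ bsupp m i ↔ bsupp m (j % 2^r) ⊆ bsupp m i := by
  simp only [bsupp, Finset.subset_iff, Finset.mem_filter, Finset.mem_range,
    Nat.testBit_mod_two_pow, Bool.and_eq_true, decide_eq_true_eq]
  constructor
  · exact fun h k hk => h ⟨hk.1, hk.2.2⟩
  · rintro h k ⟨hk, hj⟩
    by_cases hkr : k < r
    · exact h ⟨hk, hkr, hj⟩
    · exact ⟨hk, testBit_of_two_pow_sub_le hr hi him (not_lt.mp hkr) hk⟩

lemma bsupp_subset_two_pow_sub_add {m r j k : ℕ} (hr : r ≤ m) (hj : j < 2^r) (hk : k < 2^r) :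
    bsupp m k ⊆ bsupp m (2^m - 2^r + j) ↔ k &&& j = k := by
  have hjbit (t : ℕ) (ht : t < r) : (2^m - 2^r + j).testBit t = j.testBit t := by
    obtain ⟨s, rfl⟩ := Nat.exists_eq_add_of_le' hr
    have : 2^(s+r) - 2^r = 2^r * (2^s - 1) := by
      rw [Nat.mul_sub, pow_add, mul_comm, mul_one]
    rw [this, Nat.testBit_two_pow_mul_add _ hj, if_pos ht]
  have hkbit (t : ℕ) (ht : k.testBit t = true) : t < r := by
    by_contra h
    rw [Nat.testBit_lt_two_pow
      (hk.trans_le (Nat.pow_le_pow_right (by norm_num) (not_lt.mp h)))] at ht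
    exact Bool.false_ne_true ht
  simp only [bsupp, Finset.subset_iff, Finset.mem_filter, Finset.mem_range]
  constructor
  · intro h
    apply Nat.eq_of_testBit_eq
    intro t
    rw [Nat.testBit_and]
    by_cases ht : k.testBit t = true
    · have htr := hkbit t ht
      have := (h ⟨htr.trans_le hr, ht⟩).2
      rw [hjbit t htr] at this
      simp [this]
    · simp [ht]
  · rintro h t ⟨htm, ht⟩
    refine ⟨htm, ?_⟩
    rw [hjbit t (hkbit t ht)]
    rw [← h, Nat.testBit_and, Bool.and_eq_true] at ht
    exact ht.2

lemma GN_row_eq_periodicExt {m r : ℕ} (hr : r ≤ m) (j : Fin (2^r)) (i : Fin (2^m))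
    (hi : (i : ℕ) = 2^m - 2^r + j) :
    GN m i = periodicExt m r fun k => if (k : ℕ) &&& (j : ℕ) = k then 1 else 0 := by
  ext l
  rw [periodicExt_apply, GN]
  refine if_congr ?_ rfl rfl
  rw [bsupp_subset_iff_mod hr (by omega) i.2, hi]
  exact bsupp_subset_two_pow_sub_add hr j.2 (Nat.mod_lt _ (by positivity))

lemma periodicExt_single_mem_code {m r : ℕ} (hr : r ≤ m) (j : Fin (2^r)) :
    periodicExt m r (Pi.single j 1) ∈
      code (GN m) {i : Fin (2^m) | 2^m - 2^r ≤ (i : ℕ)} := by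
  induction j using WellFoundedLT.induction with
  | ind j ih =>
    have hpow : 2^r ≤ 2^m := Nat.pow_le_pow_right (by norm_num) hr
    let i : Fin (2^m) := ⟨2^m - 2^r + j, by omega⟩
    have hrow : GN m i ∈ code (GN m) {i : Fin (2^m) | 2^m - 2^r ≤ (i : ℕ)} :=
      Submodule.subset_span ⟨i, Nat.le_add_right _ _, rfl⟩
    have hsplit : (fun k : Fin (2^r) => if (k : ℕ) &&& (j : ℕ) = k then (1 : ZMod 2) else 0) =
        Pi.single j 1 +
          ∑ k ∈ Finset.univ.filter (fun k : Fin (2^r) => (k : ℕ) &&& (j : ℕ) = k ∧ k ≠ j),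
            Pi.single k 1 := by
      ext l
      by_cases hl : l = j
      · subst hl
        simp [Finset.sum_apply, Pi.single_apply]
      · simp [Finset.sum_apply, Pi.single_apply, hl]
    rw [GN_row_eq_periodicExt hr j i rfl, hsplit, map_add, map_sum] at hrow
    refine (Submodule.add_mem_iff_left _ (Submodule.sum_mem _ fun k hk => ih k ?_)).mp hrow
    obtain ⟨hkj, hne⟩ := (Finset.mem_filter.mp hk).2
    exact lt_of_le_of_ne (Fin.le_def.mpr (hkj ▸ Nat.and_le_right)) hne

lemma code_eq_range_periodicExt {m r : ℕ} (hr : r ≤ m) :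
    code (GN m) {i : Fin (2^m) | 2^m - 2^r ≤ (i : ℕ)} = LinearMap.range (periodicExt m r) := by
  apply le_antisymm
  · refine Submodule.span_le.mpr ?_
    rintro _ ⟨i, hi, rfl⟩
    have hi' : 2^m - 2^r ≤ (i : ℕ) := hi
    have hpow : 2^r ≤ 2^m := Nat.pow_le_pow_right (by norm_num) hr
    exact ⟨_, (GN_row_eq_periodicExt hr ⟨i - (2^m - 2^r), by omega⟩ i
      (by simp only; omega)).symm⟩
  · rintro _ ⟨u, rfl⟩
    rw [pi_eq_sum_univ' u, map_sum]
    refine Submodule.sum_mem _ fun k _ => ?_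
    rw [map_smul]
    refine Submodule.smul_mem _ _ ?_
    convert periodicExt_single_mem_code hr k using 2

lemma wt_pos {N : ℕ} {u : Fin N → ZMod 2} (hu : u ≠ 0) : 0 < wt u := by
  obtain ⟨k, hk⟩ := Function.ne_iff.mp hu
  exact Finset.card_pos.mpr ⟨k, by simpa using hk⟩

lemma wt_eq_one_iff {N : ℕ} {u : Fin N → ZMod 2} : wt u = 1 ↔ ∃ k, Pi.single k 1 = u := by
  constructor
  · intro h
    obtain ⟨k, hk⟩ := Finset.card_eq_one.mp h
    refine ⟨k, funext fun l => ?_⟩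
    have hl : u l ≠ 0 ↔ l = k := by simpa using Finset.ext_iff.mp hk l
    by_cases hlk : l = k
    · subst hlk
      rw [Pi.single_eq_same]
      exact (Fin.eq_one_of_ne_zero (u l) (hl.mpr rfl)).symm
    · rw [Pi.single_eq_of_ne hlk, not_not.mp (mt hl.mp hlk)]
  · rintro ⟨k, rfl⟩
    simp [wt, Pi.single_apply, Finset.filter_eq']

/-- for `0 ≤ r ≤ m`, the code `C_{G_N}({N−2^r,…,N−1})` spanned by the last
`2^r` rows of `G_N` has minimum distance `2^{m−r}`, and it contains exactly `2^r` codewords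
of Hamming weight `2^{m−r}`. -/
theorem stmt15 (m : ℕ) (hm : 0 < m) (r : ℕ) (hr : r ≤ m) :
    IsLeast {w : ℕ | ∃ v ∈ code (GN m) {i : Fin (2^m) | 2^m - 2^r ≤ (i : ℕ)},
        v ≠ 0 ∧ wt v = w} (2^(m-r))
    ∧ {v : Fin (2^m) → ZMod 2 |
        v ∈ code (GN m) {i : Fin (2^m) | 2^m - 2^r ≤ (i : ℕ)} ∧ wt v = 2^(m-r)}.ncard
      = 2^r := by
  rw [code_eq_range_periodicExt hr]
  have hset : {v : Fin (2^m) → ZMod 2 |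
      v ∈ LinearMap.range (periodicExt m r) ∧ wt v = 2^(m-r)} =
      Set.range fun k : Fin (2^r) => periodicExt m r (Pi.single k 1) := by
    ext v
    constructor
    · rintro ⟨⟨u, rfl⟩, hu⟩
      rw [wt_periodicExt hr, Nat.mul_eq_left (by positivity)] at hu
      obtain ⟨k, rfl⟩ := wt_eq_one_iff.mp hu
      exact ⟨k, rfl⟩
    · rintro ⟨k, rfl⟩
      exact ⟨⟨_, rfl⟩, by rw [wt_periodicExt hr, wt_eq_one_iff.mpr ⟨k, rfl⟩, mul_one]⟩
  refine ⟨⟨?_, ?_⟩, ?_⟩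
  · let k : Fin (2^r) := ⟨0, by positivity⟩
    refine ⟨periodicExt m r (Pi.single k 1), ⟨_, rfl⟩, ?_, ?_⟩
    · rw [Ne, map_eq_zero_iff _ (periodicExt_injective hr)]
      simp
    · rw [wt_periodicExt hr, wt_eq_one_iff.mpr ⟨k, rfl⟩, mul_one]
  · rintro _ ⟨_, ⟨u, rfl⟩, hu, rfl⟩
    rw [wt_periodicExt hr]
    exact Nat.le_mul_of_pos_right _ (wt_pos fun h => hu (by rw [h, map_zero]))
  · have hinj : Function.Injective fun k : Fin (2^r) =>
        periodicExt m r (Pi.single k 1) := by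
      intro k l h
      by_contra hkl
      have := congrFun (periodicExt_injective hr h) k
      simp [hkl] at this
    rw [hset, ← Set.image_univ, Set.ncard_image_of_injective _ hinj, Set.ncard_univ]
    simp
end
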